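/- arXiv:2402.16228 — 2 statements merged into one kernel-verified Lean document; each statement's English description precedes it below -/
import Mathlib

section
/- Oppenheim's inequality: if A = (a_{ij}) and B = (b_{ij}) are positive semidefinite n×n complex matrices, then det(A ∘ B) ≥ det(A) · b_{11} b_{22} ⋯ b_{nn}. -/
open scoped ComplexOrder

namespace Matrix

theorem det_sub_smul_single_zero {R : Type*} [CommRing R] {n : ℕ}
    (M : Matrix (Fin (n + 1)) (Fin (n + 1)) R) (c : R) :
    (M - c • single 0 0 1).det = M.det - c * (M.submatrix Fin.succ Fin.succ).det := by
  have hsub (j : Fin (n + 1)) : (M - c • single 0 0 1).submatrix Fin.succ j.succAbove =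
      M.submatrix Fin.succ j.succAbove := by
    ext i k
    simp [(Fin.succ_ne_zero i).symm]
  rw [det_succ_row_zero, det_succ_row_zero M]
  simp only [hsub, Fin.sum_univ_succ]
  simp [(Fin.succ_ne_zero _).symm, Fin.succAbove_zero]
  ring

theorem single_mul_mul_single_one {R m : Type*} [CommRing R] [Fintype m] [DecidableEq m]
    (M : Matrix m m R) (i : m) :
    single i i 1 * M * single i i 1 = M i i • single i i 1 := by
  simp [smul_single]

/-- Subtracting the Schur complement of a principal minor from the corresponding diagonal entry of
a positive definite matrix leaves a positive semidefinite matrix. -/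
theorem PosDef.posSemidef_sub_inv_smul_single {m : Type*} [Fintype m] [DecidableEq m]
    {A : Matrix m m ℂ} (hA : A.PosDef) (i : m) :
    (A - (A⁻¹ i i)⁻¹ • single i i 1).PosSemidef := by
  set E : Matrix m m ℂ := single i i 1 with hE
  have hd : 0 < A⁻¹ i i := hA.inv.diag_pos
  set d := A⁻¹ i i with hd_def
  have hdet : IsUnit A.det := (isUnit_iff_isUnit_det A).1 hA.isUnit
  have hstar : star d⁻¹ = d⁻¹ := by
    rw [star_inv₀, (IsSelfAdjoint.of_nonneg hd.le).star_eq]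
  have hEE : E * A⁻¹ * E = d • E := single_mul_mul_single_one _ _
  have hconj : (1 - d⁻¹ • (A⁻¹ * E))ᴴ = 1 - d⁻¹ • (E * A⁻¹) := by
    rw [conjTranspose_sub, conjTranspose_one, conjTranspose_smul, conjTranspose_mul,
      hA.inv.isHermitian.eq, hstar, hE, conjTranspose_single, star_one]
  have key : (1 - d⁻¹ • (A⁻¹ * E))ᴴ * A * (1 - d⁻¹ • (A⁻¹ * E)) = A - d⁻¹ • E := by
    rw [hconj, Matrix.sub_mul, Matrix.one_mul, Matrix.smul_mul, Matrix.mul_assoc,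
      nonsing_inv_mul A hdet, Matrix.mul_one, Matrix.sub_mul, Matrix.mul_sub, Matrix.mul_one,
      Matrix.mul_smul, ← Matrix.mul_assoc A, mul_nonsing_inv A hdet, Matrix.one_mul,
      Matrix.smul_mul, Matrix.mul_sub, Matrix.mul_one, Matrix.mul_smul, ← Matrix.mul_assoc E, hEE,
      smul_smul d⁻¹ d, inv_mul_cancel₀ hd.ne', one_smul, sub_self, smul_zero, sub_zero]
  exact key ▸ hA.posSemidef.conjTranspose_mul_mul_same _

/-- **Oppenheim's inequality**, in the order of `ℂ`. -/
theorem PosSemidef.det_mul_prod_diag_le_det_hadamard {n : ℕ} {A B : Matrix (Fin n) (Fin n) ℂ}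
    (hA : A.PosSemidef) (hB : B.PosSemidef) :
    A.det * ∏ i, B i i ≤ (Matrix.hadamard A B).det := by
  induction n with
  | zero => simp
  | succ n ih =>
    by_cases h0 : A.det = 0
    · rw [h0, zero_mul]
      exact (hA.hadamard hB).det_nonneg
    have hPD := hA.posDef_iff_det_ne_zero.2 h0
    set A₁ := A.submatrix Fin.succ Fin.succ with hA₁
    set B₁ := B.submatrix Fin.succ Fin.succ with hB₁
    have hd : 0 < A⁻¹ 0 0 := hPD.inv.diag_pos
    have hdA : A⁻¹ 0 0 * A.det = A₁.det := by
      rw [inv_def, smul_apply, adjugate_fin_succ_eq_det_submatrix, Ring.inverse_eq_inv']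
      simp only [hA₁, Fin.succAbove_zero, Fin.val_zero, add_zero, pow_zero, one_mul, smul_eq_mul]
      field_simp
    have hC : Matrix.hadamard (A - (A⁻¹ 0 0)⁻¹ • single 0 0 1) B =
        Matrix.hadamard A B - ((A⁻¹ 0 0)⁻¹ * B 0 0) • single 0 0 1 := by
      ext i j
      by_cases h : 0 = i ∧ 0 = j
      · obtain ⟨rfl, rfl⟩ := h
        simp [sub_mul]
      · simp [h]
    have hnn := ((hPD.posSemidef_sub_inv_smul_single 0).hadamard hB).det_nonneg
    rw [hC, det_sub_smul_single_zero, sub_nonneg] at hnn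
    refine le_trans ?_ hnn
    have hcb : 0 ≤ (A⁻¹ 0 0)⁻¹ * B 0 0 := mul_nonneg (inv_nonneg.2 hd.le) hB.diag_nonneg
    calc A.det * ∏ i, B i i
        = ((A⁻¹ 0 0)⁻¹ * B 0 0) * (A₁.det * ∏ i, B₁ i i) := by
          rw [← hdA, Fin.prod_univ_succ]
          simp only [hB₁, submatrix_apply]
          field_simp [hd.ne']
      _ ≤ _ := mul_le_mul_of_nonneg_left (ih (hA.submatrix _) (hB.submatrix _)) hcb

end Matrix

/-- Oppenheim's inequality: for positive semidefinite `n × n` complex matrices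
`A` and `B`, `det (A ∘ B) ≥ det A · b₁₁ ⋯ bₙₙ`, where `A ∘ B` is the Hadamard
(entrywise) product. -/
theorem stmt_18 {n : ℕ} (A B : Matrix (Fin n) (Fin n) ℂ)
    (hA : A.PosSemidef) (hB : B.PosSemidef) :
    A.det.re * ∏ i, (B i i).re ≤ (Matrix.hadamard A B).det.re := by
  have h := (Complex.le_def.1 (hA.det_mul_prod_diag_le_det_hadamard hB)).1
  have hdet : A.det = (A.det.re : ℂ) := Complex.eq_re_of_ofReal_le hA.det_nonneg
  have hdiag (i : Fin n) : B i i = ((B i i).re : ℂ) := Complex.eq_re_of_ofReal_le hB.diag_nonneg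
  rwa [hdet, Finset.prod_congr rfl fun i _ => hdiag i, ← Complex.ofReal_prod,
    ← Complex.ofReal_mul, Complex.ofReal_re] at h
end

section
/- Oppenheim–Schur's inequality: if A = (a_{ij}) and B = (b_{ij}) are positive semidefinite n×n complex matrices, then det(A ∘ B) + det(A) · det(B) ≥ det(A) · b_{11} b_{22} ⋯ b_{nn} + det(B) · a_{11} a_{22} ⋯ a_{nn}. -/
open scoped ComplexOrder

namespace Matrix

lemma det_add_single_zero_zero {R : Type*} [CommRing R] {n : ℕ}
    (M : Matrix (Fin (n + 1)) (Fin (n + 1)) R) (t : R) :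
    (M + single 0 0 t).det = M.det + t * (M.submatrix Fin.succ Fin.succ).det := by
  have h (j : Fin (n + 1)) : (M + single 0 0 t).submatrix Fin.succ j.succAbove =
      M.submatrix Fin.succ j.succAbove := by
    ext i k
    simp [single, (Fin.succ_ne_zero i).symm]
  rw [det_succ_row_zero, det_succ_row_zero M, Fin.sum_univ_succ, Fin.sum_univ_succ]
  simp only [h]
  simp [single, (Fin.succ_ne_zero _).symm]
  ring

/-- A positive semidefinite matrix stays positive semidefinite after subtracting from its first
diagonal entry the ratio of its determinant to its complementary principal minor. -/
lemma PosSemidef.exists_sub_single_zero_zero {n : ℕ}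
    {A : Matrix (Fin (n + 1)) (Fin (n + 1)) ℂ} (hA : A.PosSemidef) :
    ∃ d : ℝ, 0 ≤ d ∧ (A - single 0 0 (d : ℂ)).PosSemidef ∧
      A.det.re = d * (A.submatrix Fin.succ Fin.succ).det.re := by
  by_cases h0 : A.det = 0
  · exact ⟨0, le_rfl, by simpa using hA, by simp [h0]⟩
  have hpd : A.PosDef := hA.posDef_iff_det_ne_zero.2 h0
  obtain ⟨r, hr, hr'⟩ : ∃ r : ℝ, 0 < r ∧ (r : ℂ) = A⁻¹ 0 0 :=
    ⟨_, (Complex.lt_def.1 (hpd.inv.diag_pos (i := 0))).1,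
      Complex.conj_eq_iff_re.1 (hpd.inv.isHermitian.apply 0 0)⟩
  have hu : IsUnit A.det := isUnit_iff_ne_zero.2 h0
  refine ⟨r⁻¹, (inv_pos.2 hr).le, ?_, ?_⟩
  · have hE : (single 0 0 ((r⁻¹ : ℝ) : ℂ) : Matrix (Fin (n + 1)) (Fin (n + 1)) ℂ)ᴴ =
        single 0 0 ((r⁻¹ : ℝ) : ℂ) := by
      rw [conjTranspose_single]
      simp
    have hEAE : (single 0 0 ((r⁻¹ : ℝ) : ℂ) : Matrix (Fin (n + 1)) (Fin (n + 1)) ℂ) * A⁻¹ *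
        single 0 0 ((r⁻¹ : ℝ) : ℂ) = single 0 0 ((r⁻¹ : ℝ) : ℂ) := by
      rw [single_mul_mul_single, ← hr']
      have : (r : ℂ) ≠ 0 := by exact_mod_cast hr.ne'
      congr 1
      push_cast
      field_simp
    convert hA.conjTranspose_mul_mul_same (1 - A⁻¹ * single 0 0 ((r⁻¹ : ℝ) : ℂ)) using 1
    rw [conjTranspose_sub, conjTranspose_mul, hE, conjTranspose_one, hpd.inv.isHermitian.eq,
      sub_mul, sub_mul, mul_sub, mul_sub, one_mul, mul_one, nonsing_inv_mul_cancel_right _ _ hu,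
      mul_nonsing_inv_cancel_left _ _ hu, ← mul_assoc, hEAE, mul_one]
    abel
  · have hadj : A.adjugate 0 0 = (A.submatrix Fin.succ Fin.succ).det := by
      rw [adjugate_fin_succ_eq_det_submatrix]
      simp [Fin.succAbove_zero]
    have h1 : (A.submatrix Fin.succ Fin.succ).det = r * A.det := by
      rw [hr', inv_def, smul_apply, hadj, Ring.inverse_eq_inv', smul_eq_mul]
      field_simp
    rw [h1, Complex.re_ofReal_mul]
    field_simp

/-- Hadamard's inequality together with the Oppenheim–Schur inequality. -/
lemma PosSemidef.det_le_prod_diag_and_oppenheim_schur {n : ℕ}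
    {A B : Matrix (Fin n) (Fin n) ℂ} (hA : A.PosSemidef) (hB : B.PosSemidef) :
    A.det.re ≤ ∏ i, (A i i).re ∧ B.det.re ≤ ∏ i, (B i i).re ∧
    A.det.re * ∏ i, (B i i).re + B.det.re * ∏ i, (A i i).re
      ≤ (Matrix.hadamard A B).det.re + A.det.re * B.det.re := by
  induction n with
  | zero => simp
  | succ n ih =>
    have hA' := hA.submatrix Fin.succ
    have hB' := hB.submatrix Fin.succ
    obtain ⟨hHA, hHB, hL⟩ := ih hA' hB'
    obtain ⟨d, hd, hAd, hdetA⟩ := hA.exists_sub_single_zero_zero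
    obtain ⟨c, hc, hBc, hdetB⟩ := hB.exists_sub_single_zero_zero
    have hα : 0 ≤ (A.submatrix Fin.succ Fin.succ).det.re := (Complex.le_def.1 hA'.det_nonneg).1
    have hβ : 0 ≤ (B.submatrix Fin.succ Fin.succ).det.re := (Complex.le_def.1 hB'.det_nonneg).1
    have hda : d ≤ (A 0 0).re := by
      simpa using (Complex.le_def.1 (hAd.diag_nonneg (i := 0))).1
    have hcb : c ≤ (B 0 0).re := by
      simpa using (Complex.le_def.1 (hBc.diag_nonneg (i := 0))).1
    have hdecomp : Matrix.hadamard A B =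
        Matrix.hadamard (A - single 0 0 (d : ℂ)) (B - single 0 0 (c : ℂ)) +
          single 0 0 (((A 0 0).re * c + (B 0 0).re * d - d * c : ℝ) : ℂ) := by
      have ha : A 0 0 = ((A 0 0).re : ℂ) :=
        (Complex.conj_eq_iff_re.1 (hA.isHermitian.apply 0 0)).symm
      have hb : B 0 0 = ((B 0 0).re : ℂ) :=
        (Complex.conj_eq_iff_re.1 (hB.isHermitian.apply 0 0)).symm
      ext i j
      by_cases hij : 0 = i ∧ 0 = j
      · obtain ⟨rfl, rfl⟩ := hij
        simp only [hadamard_apply, add_apply, sub_apply, single_apply_same]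
        push_cast
        rw [← ha, ← hb]
        ring
      · simp [single, hij]
    have hsub : (Matrix.hadamard (A - single 0 0 (d : ℂ)) (B - single 0 0 (c : ℂ))).submatrix
        Fin.succ Fin.succ =
        Matrix.hadamard (A.submatrix Fin.succ Fin.succ) (B.submatrix Fin.succ Fin.succ) := by
      ext i j
      simp [single, (Fin.succ_ne_zero _).symm]
    have hnn := (Complex.le_def.1 (hAd.hadamard hBc).det_nonneg).1
    rw [hdecomp, det_add_single_zero_zero, hsub, Complex.add_re, Complex.re_ofReal_mul,
      hdetA, hdetB, Fin.prod_univ_succ, Fin.prod_univ_succ]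
    simp only [submatrix_apply, Complex.zero_re] at hHA hHB hL hnn
    set α := (A.submatrix Fin.succ Fin.succ).det.re
    set β := (B.submatrix Fin.succ Fin.succ).det.re
    set p := ∏ i : Fin n, (A i.succ i.succ).re
    set q := ∏ i : Fin n, (B i.succ i.succ).re
    set X := (Matrix.hadamard (A.submatrix Fin.succ Fin.succ) (B.submatrix Fin.succ Fin.succ)).det.re
    refine ⟨mul_le_mul hda hHA hα (hd.trans hda), mul_le_mul hcb hHB hβ (hc.trans hcb), ?_⟩
    have hXβ : 0 ≤ X - β * p := by nlinarith [mul_nonneg hα (sub_nonneg.2 hHB)]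
    have hXα : 0 ≤ X - α * q := by nlinarith [mul_nonneg hβ (sub_nonneg.2 hHA)]
    linear_combination hnn + mul_nonneg (mul_nonneg (sub_nonneg.2 hda) hc) hXβ +
      mul_nonneg (mul_nonneg (sub_nonneg.2 hcb) hd) hXα + mul_nonneg (mul_nonneg hd hc) (sub_nonneg.2 hL)

end Matrix

/-- Oppenheim–Schur's inequality: for positive semidefinite `n × n` complex
matrices `A` and `B`,
`det (A ∘ B) + det A · det B ≥ det A · b₁₁ ⋯ bₙₙ + det B · a₁₁ ⋯ aₙₙ`,
where `A ∘ B` is the Hadamard (entrywise) product. -/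
theorem stmt_19 {n : ℕ} (A B : Matrix (Fin n) (Fin n) ℂ)
    (hA : A.PosSemidef) (hB : B.PosSemidef) :
    A.det.re * ∏ i, (B i i).re + B.det.re * ∏ i, (A i i).re
      ≤ (Matrix.hadamard A B).det.re + A.det.re * B.det.re :=
  (hA.det_le_prod_diag_and_oppenheim_schur hB).2.2
end
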